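/- Let Σ be a set of identities and V = Mod(Σ) with every member of V abelian. Let K be a family of strongly abelian algebras all belonging to V. Then every algebra in the variety generated by K is strongly abelian: if M is an algebra for which there exist an index type I, members (K_i)_{i ∈ I} of K, a substructure S of the product Π_{i ∈ I} K_i, and a surjective L-homomorphism from S onto M, then M is strongly abelian. -/

import Mathlib

namespace UA

/-- An algebraic language: a type of operation symbols with arities. -/
structure Lang where
  F : Type
  arity : F → ℕ

variable {L : Lang}

/-- An interpretation of the language `L` on the carrier `A` (an algebra structure). -/
def Interp (L : Lang) (A : Type) : Type :=
  (f : L.F) → ((Fin (L.arity f)) → A) → A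

/-- Terms of the language `L` over a type `X` of variables. -/
inductive Term (L : Lang) (X : Type) : Type
  | var : X → Term L X
  | app : (f : L.F) → ((Fin (L.arity f)) → Term L X) → Term L X

/-- Realization of a term under an assignment of the variables. -/
def Term.realize {A X : Type} (I : Interp L A) (v : X → A) : Term L X → A
  | .var x => v x
  | .app f ts => I f (fun i => (ts i).realize I v)

/-- Relabelling (substitution of variables) of terms. -/
def Term.relabel {X Y : Type} (g : X → Y) : Term L X → Term L Y
  | .var x => .var (g x)
  | .app f ts => .app f (fun i => (ts i).relabel g)

/-- `p` is a polynomial operation of the algebra `(A, I)` with argument-index type `X`: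
it is the realization of a term in variables `X ⊕ Fin m` where the `Fin m` variables
are evaluated at fixed constants. -/
def IsPolyOp {A X : Type} (I : Interp L A) (p : (X → A) → A) : Prop :=
  ∃ (m : ℕ) (t : Term L (X ⊕ Fin m)) (c : Fin m → A),
    ∀ x : X → A, p x = t.realize I (Sum.elim x c)

/-- A unary polynomial operation. -/
def IsUnaryPolyOp {A : Type} (I : Interp L A) (g : A → A) : Prop :=
  IsPolyOp I (fun x : Fin 1 → A => g (x 0))

/-- `(p, q, r, s)` is a `1,1`-matrix of the algebra `(A, I)`. -/
def Is11Matrix {A : Type} (I : Interp L A) (p q r s : A) : Prop :=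
  ∃ (k l : ℕ) (t : ((Fin k ⊕ Fin l) → A) → A), IsPolyOp I t ∧
    ∃ (a b : Fin k → A) (u v : Fin l → A),
      p = t (Sum.elim a u) ∧ q = t (Sum.elim a v) ∧
      r = t (Sum.elim b u) ∧ s = t (Sum.elim b v)

/-- The algebra is abelian: in every `1,1`-matrix, `p = q` implies `r = s`. -/
def IsAbelian {A : Type} (I : Interp L A) : Prop :=
  ∀ p q r s : A, Is11Matrix I p q r s → p = q → r = s

/-- The algebra is strongly rectangular: in every `1,1`-matrix, `q = r` implies `r = s`. -/
def IsStronglyRectangular {A : Type} (I : Interp L A) : Prop :=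
  ∀ p q r s : A, Is11Matrix I p q r s → q = r → r = s

/-- Strongly abelian = abelian + strongly rectangular. -/
def IsStronglyAbelian {A : Type} (I : Interp L A) : Prop :=
  IsAbelian I ∧ IsStronglyRectangular I

/-- The algebra has a Maltsev polynomial operation. -/
def HasMaltsevPoly {A : Type} (I : Interp L A) : Prop :=
  ∃ mOp : (Fin 3 → A) → A, IsPolyOp I mOp ∧
    ∀ x y : A, mOp ![x, y, y] = x ∧ mOp ![y, y, x] = x

/-- Affine = abelian + has a Maltsev polynomial operation. -/
def IsAffine {A : Type} (I : Interp L A) : Prop :=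
  IsAbelian I ∧ HasMaltsevPoly I

/-- The algebra satisfies the identity `e.1 ≈ e.2`. -/
def Satisfies {A : Type} (I : Interp L A) (e : Term L ℕ × Term L ℕ) : Prop :=
  ∀ v : ℕ → A, e.1.realize I v = e.2.realize I v

/-- Membership in the variety `Mod(E)` axiomatized by the set `E` of identities. -/
def InVariety {A : Type} (E : Set (Term L ℕ × Term L ℕ)) (I : Interp L A) : Prop :=
  ∀ e ∈ E, Satisfies I e

/-- `θ` is a congruence on the algebra `(A, I)`. -/
def IsCong {A : Type} (I : Interp L A) (θ : A → A → Prop) : Prop :=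
  Equivalence θ ∧
    ∀ (f : L.F) (a b : Fin (L.arity f) → A),
      (∀ i, θ (a i) (b i)) → θ (I f a) (I f b)

/-- `(p, q, r, s)` is a `θ`-matrix of the algebra `(A, I)`. -/
def IsThetaMatrix {A : Type} (I : Interp L A) (θ : A → A → Prop) (p q r s : A) : Prop :=
  ∃ (k l : ℕ) (t : ((Fin k ⊕ Fin l) → A) → A), IsPolyOp I t ∧
    ∃ (a b : Fin k → A) (u v : Fin l → A),
      (∀ i, θ (a i) (b i)) ∧ (∀ j, θ (u j) (v j)) ∧
      p = t (Sum.elim a u) ∧ q = t (Sum.elim a v) ∧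
      r = t (Sum.elim b u) ∧ s = t (Sum.elim b v)

/-- `θ` is a strongly abelian congruence. -/
def IsStronglyAbelianCong {A : Type} (I : Interp L A) (θ : A → A → Prop) : Prop :=
  ∀ p q r s : A, IsThetaMatrix I θ p q r s → (p = q → r = s) ∧ (q = r → r = s)

/-- `S` is a subuniverse of the algebra `(A, I)`. -/
def IsSubuniverse {A : Type} (I : Interp L A) (S : Set A) : Prop :=
  ∀ (f : L.F) (a : Fin (L.arity f) → A), (∀ i, a i ∈ S) → I f a ∈ S

/-- The substructure (restricted algebra structure) on a subuniverse. -/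
def subInterp {A : Type} (I : Interp L A) (S : Set A) (hS : IsSubuniverse I S) :
    Interp L S :=
  fun f a => ⟨I f (fun i => (a i : A)), hS f _ (fun i => (a i).2)⟩

/-- The componentwise algebra structure on a product. -/
def prodInterp {ι : Type} {A : ι → Type} (I : ∀ i, Interp L (A i)) :
    Interp L (∀ i, A i) :=
  fun f a i => I i f (fun j => a j i)

/-- The componentwise algebra structure on `A × A`. -/
def pairInterp {A : Type} (I : Interp L A) : Interp L (A × A) :=
  fun f a => (I f (fun i => (a i).1), I f (fun i => (a i).2))

/-- `h` is a homomorphism of `L`-algebras. -/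
def IsHom {A B : Type} (I : Interp L A) (J : Interp L B) (h : A → B) : Prop :=
  ∀ (f : L.F) (a : Fin (L.arity f) → A), h (I f a) = J f (fun i => h (a i))

/-- The induced algebra structure on the quotient by a congruence `ρ`
(well-defined, i.e. independent of the chosen representatives, when `ρ` is a congruence). -/
noncomputable def quotInterp {A : Type} (I : Interp L A) (ρ : A → A → Prop) :
    Interp L (Quot ρ) :=
  fun f a => Quot.mk ρ (I f (fun i => (a i).out))

/-- The subuniverse generated by a subset `G`: the intersection of all
subuniverses containing `G`. -/
def GenSub {A : Type} (I : Interp L A) (G : Set A) : Set A :=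
  {x | ∀ S : Set A, IsSubuniverse I S → G ⊆ S → x ∈ S}

theorem genSub_isSubuniverse {A : Type} (I : Interp L A) (G : Set A) :
    IsSubuniverse I (GenSub I G) :=
  fun f a ha S hS hG => hS f a (fun i => ha i S hS hG)

/-- The smallest congruence containing the pair `(x, y)`: the intersection of all
congruences containing it. -/
def genCong {A : Type} (I : Interp L A) (x y : A) : A → A → Prop :=
  fun w z => ∀ ρ : A → A → Prop, IsCong I ρ → ρ x y → ρ w z

/-- The carrier of `A(θ)`, the graph of `θ` inside `A × A`. -/
abbrev ThetaSub {A : Type} (θ : A → A → Prop) : Type := {z : A × A // θ z.1 z.2}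

/-- The substructure `A(θ) ≤ A × A` supported by the graph of `θ`. -/
def thetaSubInterp {A : Type} (I : Interp L A) (θ : A → A → Prop) (hθ : IsCong I θ) :
    Interp L (ThetaSub θ) :=
  fun f a => ⟨(I f (fun i => (a i).1.1), I f (fun i => (a i).1.2)),
    hθ.2 f _ _ (fun i => (a i).2)⟩

/-- The diagonal element `(c, c)` of `A(θ)`. -/
def diagEl {A : Type} {θ : A → A → Prop} (hrefl : ∀ a : A, θ a a) (c : A) :
    ThetaSub θ := ⟨(c, c), hrefl c⟩

/-- `Δ`: the smallest congruence of `A(θ)` containing `D × D`, where `D` is the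
diagonal -- the intersection of all congruences of `A(θ)` containing `D × D`. -/
def DeltaRel {A : Type} (I : Interp L A) (θ : A → A → Prop) (hθ : IsCong I θ) :
    ThetaSub θ → ThetaSub θ → Prop :=
  fun x y => ∀ ρ : ThetaSub θ → ThetaSub θ → Prop,
    IsCong (thetaSubInterp I θ hθ) ρ →
    (∀ c d : A, ρ (diagEl hθ.1.refl c) (diagEl hθ.1.refl d)) → ρ x y

/-- The quotient algebra `S = A(θ)/Δ`. -/
noncomputable def SInterp {A : Type} (I : Interp L A) (θ : A → A → Prop)
    (hθ : IsCong I θ) : Interp L (Quot (DeltaRel I θ hθ)) :=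
  quotInterp (thetaSubInterp I θ hθ) (DeltaRel I θ hθ)

/-- The element `0` of `S = A(θ)/Δ`: the `Δ`-class of a diagonal element. -/
def zeroS {A : Type} (I : Interp L A) (θ : A → A → Prop) (hθ : IsCong I θ) (d : A) :
    Quot (DeltaRel I θ hθ) :=
  Quot.mk _ (diagEl hθ.1.refl d)

/-- The diagonal of `B × B`. -/
def diagSet (B : Type) : Set (B × B) := {z | z.1 = z.2}

/-- The set of pairs `(u j, v j)`. -/
def pairsSet {B : Type} {l : ℕ} (u v : Fin l → B) : Set (B × B) :=
  {z | ∃ j, z = (u j, v j)}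

/-- The carrier of the subalgebra `C ≤ B × B` generated by the diagonal and the
pairs `(u j, v j)`. -/
def CsetOf {L : Lang} {B : Type} (I : Interp L B) {l : ℕ} (u v : Fin l → B) :
    Set (B × B) :=
  GenSub (pairInterp I) (diagSet B ∪ pairsSet u v)

/-- The subalgebra `C ≤ B × B` generated by the diagonal and the pairs `(u j, v j)`. -/
def CInterpOf {L : Lang} {B : Type} (I : Interp L B) {l : ℕ} (u v : Fin l → B) :
    Interp L (CsetOf I u v) :=
  subInterp (pairInterp I) _ (genSub_isSubuniverse _ _)


section Terms

variable {A B X Y : Type}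

/-- The algebra of terms over a set of variables. -/
def termInterp (L : Lang) (X : Type) : Interp L (Term L X) := Term.app

theorem IsHom.map_realize {I : Interp L A} {J : Interp L B} {h : A → B} (hh : IsHom I J h)
    (e : Term L X) (v : X → A) : h (e.realize I v) = e.realize J (h ∘ v) := by
  induction e with
  | var x => rfl
  | app f ts ih => simp only [Term.realize, hh f, ih]

theorem realize_isHom (I : Interp L A) (v : X → A) :
    IsHom (termInterp L X) I (Term.realize I v) :=
  fun _ _ => rfl

theorem realize_subst (I : Interp L A) (v : Y → A) (e : Term L X) (s : X → Term L Y) :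
    (e.realize (termInterp L Y) s).realize I v = e.realize I (fun x => (s x).realize I v) :=
  (realize_isHom I v).map_realize e s

theorem realize_var (e : Term L X) : e.realize (termInterp L X) Term.var = e := by
  induction e with
  | var x => rfl
  | app f ts ih => simp only [Term.realize, ih]; rfl

theorem realize_eq_of_surjective {I : Interp L A} {J : Interp L B} {h : A → B}
    (hh : IsHom I J h) (hsurj : Function.Surjective h) (e : Term L X) (v : X → B) :
    e.realize J v = h (e.realize I (Function.surjInv hsurj ∘ v)) := by
  rw [hh.map_realize, ← Function.comp_assoc, (Function.rightInverse_surjInv hsurj).comp_eq_id,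
    Function.id_comp]

theorem InVariety.of_surjective {E : Set (Term L ℕ × Term L ℕ)} {I : Interp L A}
    {J : Interp L B} (hI : InVariety E I) {h : A → B} (hh : IsHom I J h)
    (hsurj : Function.Surjective h) : InVariety E J := by
  intro e he v
  rw [realize_eq_of_surjective hh hsurj, realize_eq_of_surjective hh hsurj, hI e he]

theorem InVariety.of_jointly_injective {E : Set (Term L ℕ × Term L ℕ)} {ι : Type}
    {B : ι → Type} {I : Interp L A} {J : ∀ i, Interp L (B i)} (hJ : ∀ i, InVariety E (J i))
    {h : ∀ i, A → B i} (hh : ∀ i, IsHom I (J i) (h i))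
    (hinj : ∀ x y, (∀ i, h i x = h i y) → x = y) : InVariety E I := by
  intro e he v
  refine hinj _ _ fun i => ?_
  rw [(hh i).map_realize, (hh i).map_realize, hJ i e he]

end Terms

section Matrices

variable {A B Y : Type}

theorem Is11Matrix.map {I : Interp L A} {J : Interp L B} {h : A → B} (hh : IsHom I J h)
    {p q r s : A} (H : Is11Matrix I p q r s) : Is11Matrix J (h p) (h q) (h r) (h s) := by
  obtain ⟨k, l, t, ⟨m, e, c, ht⟩, a, b, u, v, rfl, rfl, rfl, rfl⟩ := H
  refine ⟨k, l, fun x => e.realize J (Sum.elim x (h ∘ c)), ⟨m, e, h ∘ c, fun _ => rfl⟩,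
    h ∘ a, h ∘ b, h ∘ u, h ∘ v, ?_⟩
  simp only [ht, hh.map_realize, Sum.comp_elim, and_self]

theorem IsStronglyAbelian.of_jointly_injective {ι : Type} {B : ι → Type} {I : Interp L A}
    {J : ∀ i, Interp L (B i)} (hJ : ∀ i, IsStronglyAbelian (J i))
    {h : ∀ i, A → B i} (hh : ∀ i, IsHom I (J i) (h i))
    (hinj : ∀ x y, (∀ i, h i x = h i y) → x = y) : IsStronglyAbelian I :=
  ⟨fun _ _ _ _ H e => hinj _ _ fun i => (hJ i).1 _ _ _ _ (H.map (hh i)) (congrArg _ e),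
    fun _ _ _ _ H e => hinj _ _ fun i => (hJ i).2 _ _ _ _ (H.map (hh i)) (congrArg _ e)⟩

/-- Four assignments such that each variable changes either only between rows or only
between columns. -/
def IsGrid (α β γ δ : Y → A) : Prop :=
  ∀ y, (α y = β y ∧ γ y = δ y) ∨ (α y = γ y ∧ β y = δ y)

theorem IsGrid.is11Matrix [Finite Y] (I : Interp L A) {α β γ δ : Y → A}
    (H : IsGrid α β γ δ) (e : Term L Y) :
    Is11Matrix I (e.realize I α) (e.realize I β) (e.realize I γ) (e.realize I δ) := by
  classical
  obtain ⟨n, ⟨φ⟩⟩ := Finite.exists_equiv_fin Y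
  let sel : Y → Fin n ⊕ Fin n := fun y =>
    if α y = β y ∧ γ y = δ y then Sum.inl (φ y) else Sum.inr (φ y)
  refine ⟨n, n, fun x => e.realize I (fun y => x (sel y)),
    ⟨0, e.realize (termInterp L _) (fun y => .var (.inl (sel y))), Fin.elim0,
      fun x => (realize_subst I (Sum.elim x Fin.elim0) e fun y => .var (.inl (sel y))).symm⟩,
    α ∘ φ.symm, γ ∘ φ.symm, α ∘ φ.symm, β ∘ φ.symm, ?_, ?_, ?_, ?_⟩ <;>
  · refine congrArg (fun w => Term.realize I w e) (funext fun y => ?_)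
    have := H y
    by_cases hy : α y = β y ∧ γ y = δ y <;> simp [sel, hy] <;> grind

/-- In a strongly abelian algebra, if a term function does not depend on a tuple substituted
simultaneously in two blocks of variables for one value of the remaining variables, then it
depends on neither block, whatever the value of a third block. -/
theorem IsStronglyAbelian.indep_of_diag {P Z W : Type} [Finite P] [Finite Z] [Finite W]
    {I : Interp L A} (hI : IsStronglyAbelian I) (e : Term L ((P ⊕ Z) ⊕ (W ⊕ Z)))
    (w : W → A) (x₀ : P → A)
    (hdiag : ∀ z z' : Z → A, e.realize I (Sum.elim (Sum.elim x₀ z) (Sum.elim w z)) =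
      e.realize I (Sum.elim (Sum.elim x₀ z') (Sum.elim w z')))
    (x : P → A) (z₁ z₂ z₁' z₂' : Z → A) :
    e.realize I (Sum.elim (Sum.elim x z₁) (Sum.elim w z₂)) =
      e.realize I (Sum.elim (Sum.elim x z₁') (Sum.elim w z₂')) := by
  have off (z z' : Z → A) : e.realize I (Sum.elim (Sum.elim x₀ z') (Sum.elim w z')) =
      e.realize I (Sum.elim (Sum.elim x₀ z') (Sum.elim w z)) := by
    refine hI.2 _ _ _ _ (IsGrid.is11Matrix I
      (α := Sum.elim (Sum.elim x₀ z) (Sum.elim w z'))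
      (β := Sum.elim (Sum.elim x₀ z) (Sum.elim w z)) ?_ e) (hdiag z z')
    rintro ((_ | _) | (_ | _)) <;> simp
  refine hI.1 _ _ _ _ (IsGrid.is11Matrix I
    (α := Sum.elim (Sum.elim x₀ z₁) (Sum.elim w z₂))
    (β := Sum.elim (Sum.elim x₀ z₁') (Sum.elim w z₂')) ?_ e) ?_
  · rintro ((_ | _) | (_ | _)) <;> simp
  · rw [← off z₂ z₁, ← off z₂' z₁', hdiag]

end Matrices

section Contexts

variable {X : Type}

/-- Substitution of a term for the hole of a context. -/
def plug (D : Term L (X ⊕ Unit)) (e : Term L X) : Term L X :=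
  D.realize (termInterp L X) (Sum.elim Term.var fun _ => e)

/-- Terms that are related by `Φ` in every context. -/
def ContextRel (Φ : Term L X → Term L X → Prop) (e e' : Term L X) : Prop :=
  ∀ D : Term L (X ⊕ Unit), Φ (plug D e) (plug D e')

theorem ContextRel.rel {Φ : Term L X → Term L X → Prop} {e e' : Term L X}
    (H : ContextRel Φ e e') : Φ e e' :=
  H (.var (.inr ()))

theorem realize_plug {A : Type} (I : Interp L A) (v : X → A) (D : Term L (X ⊕ Unit))
    (e : Term L X) :
    (plug D e).realize I v = D.realize I (Sum.elim v fun _ => e.realize I v) := by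
  rw [plug, realize_subst]
  congr 1
  funext x
  cases x <;> rfl

theorem ContextRel.isCong {Φ : Term L X → Term L X → Prop} (hΦ : Equivalence Φ) :
    IsCong (termInterp L X) (ContextRel Φ) := by
  classical
  refine ⟨⟨fun _ _ => hΦ.refl _, fun H D => hΦ.symm (H D),
    fun H H' D => hΦ.trans (H D) (H' D)⟩, fun f a b hab D => ?_⟩
  have step (c : Fin (L.arity f) → Term L X) (j) {x y : Term L X} (hxy : ContextRel Φ x y) :
      Φ (plug D (.app f (Function.update c j x))) (plug D (.app f (Function.update c j y))) := by
    let D' : Term L (X ⊕ Unit) := D.realize (termInterp L _) (Sum.elim (.var ∘ .inl) fun _ =>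
      .app f (Function.update (fun i => (c i).realize (termInterp L _) (.var ∘ .inl)) j
        (.var (.inr ()))))
    have hD' (e : Term L X) : plug D' e = plug D (.app f (Function.update c j e)) := by
      rw [plug, realize_subst, plug]
      congr 1
      funext i
      rcases i with i | i
      · rfl
      · refine congrArg (Term.app f) (funext fun i => ?_)
        by_cases hi : i = j
        · subst hi
          simp [Term.realize]
        · simp only [Function.update_of_ne hi, realize_subst]
          exact realize_var (c i)
    rw [← hD', ← hD']
    exact hxy D'
  have key (s : Finset (Fin (L.arity f))) :
      Φ (plug D (.app f a)) (plug D (.app f (s.piecewise b a))) := by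
    induction s using Finset.induction with
    | empty => simpa using hΦ.refl _
    | insert j s hj ih =>
      rw [Finset.piecewise_insert]
      refine hΦ.trans ih ?_
      have := step (s.piecewise b a) j (hab j)
      rwa [← Finset.piecewise_eq_of_notMem s b a hj, Function.update_eq_self] at this
  have := key Finset.univ
  rwa [Finset.piecewise_univ] at this

end Contexts

theorem quot_mk_isHom {A : Type} {I : Interp L A} {ρ : A → A → Prop} (hρ : IsCong I ρ) :
    IsHom I (quotInterp I ρ) (Quot.mk ρ) := by
  refine fun f a => Quot.sound (hρ.2 f _ _ fun i => ?_)
  rw [← hρ.1.quot_mk_eq_iff]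
  exact (Quot.out_eq _).symm

section Independence

variable {A M W Z : Type}

/-- The term function of `e` does not depend on the second block of variables. -/
def IndepSnd (I : Interp L A) (e : Term L (W ⊕ Z)) : Prop :=
  ∀ (w : W → A) (z z' : Z → A), e.realize I (Sum.elim w z) = e.realize I (Sum.elim w z')

/-- Both or neither of two terms are independent of the second block of variables over `I`;
in the former case their values over `J` agree when the first block is assigned `w`. -/
def IndepRel (I : Interp L A) (J : Interp L M) (w : W → M) (e e' : Term L (W ⊕ Z)) : Prop :=
  (IndepSnd I e ↔ IndepSnd I e') ∧
    (IndepSnd I e → ∀ z, e.realize J (Sum.elim w z) = e'.realize J (Sum.elim w z))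

theorem indepRel_equivalence (I : Interp L A) (J : Interp L M) (w : W → M) :
    Equivalence (IndepRel (Z := Z) I J w) where
  refl _ := ⟨Iff.rfl, fun _ _ => rfl⟩
  symm H := ⟨H.1.symm, fun h z => (H.2 (H.1.2 h) z).symm⟩
  trans H H' := ⟨H.1.trans H'.1, fun h z => (H.2 h z).trans (H'.2 (H.1.1 h) z)⟩

theorem contextRel_of_identity {I : Interp L A} {J : Interp L M} {h : A → M}
    (hh : IsHom I J h) (hsurj : Function.Surjective h) (w : W → M) {e e' : Term L (W ⊕ Z)}
    (H : ∀ v, e.realize I v = e'.realize I v) : ContextRel (IndepRel I J w) e e' := by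
  intro D
  have hD (v) : (plug D e).realize I v = (plug D e').realize I v := by
    rw [realize_plug, realize_plug, H]
  refine ⟨by simp only [IndepSnd, hD], fun _ z => ?_⟩
  rw [realize_eq_of_surjective hh hsurj, realize_eq_of_surjective hh hsurj, hD]

/-- If `t(a, u) = t(b, v)` holds in `J`, then the terms `t(x, z)` and `t(y, z)` are related in
every context as soon as `x`, `y` are assigned the values `a`, `b`. -/
theorem contextRel_of_eq {P C : Type} [Finite P] [Finite Z] [Finite W] {I : Interp L A}
    {J : Interp L M} {h : A → M} (hI : IsStronglyAbelian I)
    (hh : IsHom I J h) (hsurj : Function.Surjective h) (w : W → M)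
    (t : Term L ((P ⊕ Z) ⊕ C)) (x y : P → W) (c : C → W) {u v : Z → M}
    (H : t.realize J (Sum.elim (Sum.elim (w ∘ x) u) (w ∘ c)) =
      t.realize J (Sum.elim (Sum.elim (w ∘ y) v) (w ∘ c))) :
    ContextRel (IndepRel I J w)
      (t.realize (termInterp L (W ⊕ Z))
        (Term.var ∘ Sum.elim (Sum.elim (.inl ∘ x) .inr) (.inl ∘ c)))
      (t.realize (termInterp L (W ⊕ Z))
        (Term.var ∘ Sum.elim (Sum.elim (.inl ∘ y) .inr) (.inl ∘ c))) := by
  intro D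
  let e : Term L ((P ⊕ Z) ⊕ (W ⊕ Z)) := D.realize (termInterp L _)
    (Sum.elim (.var ∘ .inr) fun _ => t.realize (termInterp L _)
      (Sum.elim (.var ∘ .inl) (.var ∘ .inr ∘ .inl ∘ c)))
  have he {A' : Type} (I' : Interp L A') (p : P → A') (z₁ z₂ : Z → A') (w' : W → A') :
      e.realize I' (Sum.elim (Sum.elim p z₁) (Sum.elim w' z₂)) =
        D.realize I' (Sum.elim (Sum.elim w' z₂)
          fun _ => t.realize I' (Sum.elim (Sum.elim p z₁) (w' ∘ c))) := by
    rw [realize_subst]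
    congr 1
    funext i
    rcases i with i | i
    · rfl
    · refine (realize_subst _ _ _ _).trans ?_
      congr 1
      funext j
      rcases j with j | j <;> rfl
  have hplug {A' : Type} (I' : Interp L A') (w' : W → A') (z : Z → A') (x : P → W) :
      (plug D (t.realize (termInterp L (W ⊕ Z))
        (Term.var ∘ Sum.elim (Sum.elim (.inl ∘ x) .inr) (.inl ∘ c)))).realize I'
          (Sum.elim w' z) =
        e.realize I' (Sum.elim (Sum.elim (w' ∘ x) z) (Sum.elim w' z)) := by
    rw [realize_plug, he, realize_subst]
    congr 3
    funext _
    congr 1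
    funext j
    rcases j with (j | j) | j <;> rfl
  have hind (x : P → W) (hx : IndepSnd I (plug D (t.realize (termInterp L (W ⊕ Z))
      (Term.var ∘ Sum.elim (Sum.elim (.inl ∘ x) .inr) (.inl ∘ c))))) (w' : W → A) :=
    hI.indep_of_diag e w' (w' ∘ x) fun z z' => by rw [← hplug, ← hplug]; exact hx w' z z'
  refine ⟨⟨fun hx w' z z' => ?_, fun hy w' z z' => ?_⟩, fun hx z => ?_⟩
  · rw [hplug, hplug]
    exact hind x hx w' _ _ _ _ _
  · rw [hplug, hplug]
    exact hind y hy w' _ _ _ _ _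
  · have hJ (p : P → M) (z₁ z₂ z₁' z₂' : Z → M) :
        e.realize J (Sum.elim (Sum.elim p z₁) (Sum.elim w z₂)) =
          e.realize J (Sum.elim (Sum.elim p z₁') (Sum.elim w z₂')) := by
      rw [realize_eq_of_surjective hh hsurj, realize_eq_of_surjective hh hsurj]
      simp only [Sum.comp_elim]
      rw [hind x hx]
    rw [hplug, hplug, hJ _ z z u z, hJ _ z z v z, he, he, H]

end Independence

/-- In a variety of abelian algebras, homomorphic images of strongly abelian algebras are
strongly abelian. -/
theorem IsStronglyAbelian.of_surjective {E : Set (Term L ℕ × Term L ℕ)}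
    (habelian : ∀ (A : Type) (I : Interp L A), InVariety E I → IsAbelian I)
    {A M : Type} {I : Interp L A} {J : Interp L M} (hE : InVariety E I)
    (hI : IsStronglyAbelian I) {h : A → M} (hh : IsHom I J h)
    (hsurj : Function.Surjective h) : IsStronglyAbelian J := by
  refine ⟨habelian M J (hE.of_surjective hh hsurj), ?_⟩
  rintro p q r s ⟨k, l, T, ⟨m, t, d, hT⟩, a, b, u, v, rfl, rfl, rfl, rfl⟩ hqr
  simp only [hT] at hqr ⊢
  let w : Fin k ⊕ Fin k ⊕ Fin l ⊕ Fin m → M := Sum.elim b (Sum.elim a (Sum.elim v d))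
  let c : Fin m → Fin k ⊕ Fin k ⊕ Fin l ⊕ Fin m := .inr ∘ .inr ∘ .inr
  let x : Fin k → Fin k ⊕ Fin k ⊕ Fin l ⊕ Fin m := .inl
  let y : Fin k → Fin k ⊕ Fin k ⊕ Fin l ⊕ Fin m := .inr ∘ .inl
  let z' : Fin l → Fin k ⊕ Fin k ⊕ Fin l ⊕ Fin m := .inr ∘ .inr ∘ .inl
  have hcong := ContextRel.isCong (indepRel_equivalence (Z := Fin l) I J w)
  set σ := ContextRel (IndepRel (Z := Fin l) I J w) with hσ
  have hmk := quot_mk_isHom hcong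
  have hQ : InVariety E (quotInterp (termInterp L _) σ) := by
    intro e he α
    rw [realize_eq_of_surjective hmk Quot.mk_surjective,
      realize_eq_of_surjective hmk Quot.mk_surjective]
    refine Quot.sound (contextRel_of_identity hh hsurj w fun β => ?_)
    rw [realize_subst, realize_subst, hE e he]
  have hxy := Quot.sound (contextRel_of_eq hI hh hsurj w t x y c (u := u) (v := v) hqr.symm)
  rw [← hσ, hmk.map_realize, hmk.map_realize] at hxy
  have hxy' := habelian _ _ hQ _ _ _ _ (IsGrid.is11Matrix _
    (γ := Quot.mk σ ∘ Term.var ∘ Sum.elim (Sum.elim (.inl ∘ x) (.inl ∘ z')) (.inl ∘ c))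
    (δ := Quot.mk σ ∘ Term.var ∘ Sum.elim (Sum.elim (.inl ∘ y) (.inl ∘ z')) (.inl ∘ c))
    (by rintro ((_ | _) | _) <;> simp) t) hxy
  rw [← hmk.map_realize, ← hmk.map_realize, hcong.1.quot_mk_eq_iff] at hxy'
  have hval {A' : Type} (I' : Interp L A') (w' : _ → A') (z : Fin l → A')
      (x : Fin k → Fin k ⊕ Fin k ⊕ Fin l ⊕ Fin m) :
      (t.realize (termInterp L _) (Term.var ∘
        Sum.elim (Sum.elim (.inl ∘ x) (.inl ∘ z')) (.inl ∘ c))).realize I' (Sum.elim w' z) =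
        t.realize I' (Sum.elim (Sum.elim (w' ∘ x) (w' ∘ z')) (w' ∘ c)) := by
    rw [realize_subst]
    congr 1
    funext j
    rcases j with (j | j) | j <;> rfl
  have hbv := hxy'.rel.2 (fun w' z₁ z₂ => by rw [hval, hval]) v
  rw [hval, hval] at hbv
  exact hqr.symm.trans hbv.symm

/-- Let `Mod(E)` be a variety all of whose members are abelian, and let
`K` be a family of strongly abelian members of `Mod(E)`. Then every algebra in the
variety generated by `K` (every surjective-homomorphic image of a substructure of a
product of members of `K`) is strongly abelian. -/
theorem statement18 {L : Lang} (E : Set (Term L ℕ × Term L ℕ))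
    (habelian : ∀ (A : Type) (I : Interp L A), InVariety E I → IsAbelian I)
    (κ : Type) (Kc : κ → Type) (KI : ∀ i, Interp L (Kc i))
    (hK : ∀ i, InVariety E (KI i) ∧ IsStronglyAbelian (KI i))
    (M : Type) (J : Interp L M)
    (ι : Type) (g : ι → κ)
    (S : Set (∀ i : ι, Kc (g i)))
    (hS : IsSubuniverse (prodInterp (fun i : ι => KI (g i))) S)
    (h : S → M)
    (hh : IsHom (subInterp (prodInterp (fun i : ι => KI (g i))) S hS) J h)
    (hsurj : Function.Surjective h) :
    IsStronglyAbelian J := by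
  have hhom (i : ι) : IsHom (subInterp (prodInterp (fun i : ι => KI (g i))) S hS) (KI (g i))
      (fun x => x.1 i) := fun _ _ => rfl
  have hinj (x y : S) (hxy : ∀ i, x.1 i = y.1 i) : x = y := Subtype.ext (funext hxy)
  exact IsStronglyAbelian.of_surjective habelian
    (InVariety.of_jointly_injective (fun i => (hK (g i)).1) hhom hinj)
    (IsStronglyAbelian.of_jointly_injective (fun i => (hK (g i)).2) hhom hinj) hh hsurj

end UA
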